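/- For every natural number p and every ℂ-valued alternating p-linear map ψ on the dual space E*, the composition satisfies c(j(ψ)) = p!·(m − p)·ψ, where m = dim E. -/

import Mathlib

open Module

/-- The map `j`: given a `ℂ`-valued alternating `p`-linear map `ψ` on `E*`, the
`E*`-valued `(p+1)`-linear map
`j(ψ)(x₁, …, x_{p+1}) = p! · Σ_k (−1)^{k−1} ψ(x₁, …, x̂_k, …, x_{p+1}) · x_k`
(written here as a raw function). -/
noncomputable def jRaw {E : Type*} [AddCommGroup E] [Module ℂ E] {p : ℕ}
    (ψ : (Module.Dual ℂ E) [⋀^(Fin p)]→ₗ[ℂ] ℂ) :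
    (Fin (p + 1) → Module.Dual ℂ E) → Module.Dual ℂ E :=
  fun x =>
    (p.factorial : ℂ) •
      ∑ k : Fin (p + 1), ((-1 : ℂ) ^ (k : ℕ)) •
        ((ψ fun i => x (k.succAbove i)) • x k)

/-- The contraction map `c`: given an `E*`-valued `(p+1)`-linear map `φ` on `E*`
(as a raw function) and a basis `ξ` of `E` with dual basis `ξ*`, the `ℂ`-valued
`p`-linear map `c(φ)(x₁, …, x_p) = Σ_k φ(ξ_k*, x₁, …, x_p)(ξ_k)`. -/
noncomputable def cRaw {E : Type*} [AddCommGroup E] [Module ℂ E] {m p : ℕ}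
    (ξ : Basis (Fin m) ℂ E)
    (φ : (Fin (p + 1) → Module.Dual ℂ E) → Module.Dual ℂ E) :
    (Fin p → Module.Dual ℂ E) → ℂ :=
  fun x => ∑ k : Fin m, (φ (Fin.cons (ξ.dualBasis k) x)) (ξ k)

/-- Replacing the `i`-th argument of an alternating form by a dual basis vector moved to the front
and contracting with the basis gives back the form, up to the sign `(-1) ^ i`. -/
lemma sum_apply_cons_dualBasis_succAbove {E : Type*} [AddCommGroup E] [Module ℂ E] {m p : ℕ}
    (ξ : Basis (Fin m) ℂ E) (ψ : (Module.Dual ℂ E) [⋀^(Fin p)]→ₗ[ℂ] ℂ)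
    (x : Fin p → Module.Dual ℂ E) (i : Fin p) :
    ∑ k : Fin m, x i (ξ k) *
      ψ (fun j => (Fin.cons (ξ.dualBasis k) x : Fin (p + 1) → Module.Dual ℂ E)
        (i.succ.succAbove j)) = (-1) ^ (i : ℕ) * ψ x := by
  obtain _ | n := p
  · exact i.elim0
  have hcons (k : Fin m) :
      (fun j => (Fin.cons (ξ.dualBasis k) x : Fin (n + 2) → Module.Dual ℂ E)
        (i.succ.succAbove j)) = Matrix.vecCons (ξ.dualBasis k) (i.removeNth x) := by
    funext j
    refine Fin.cases ?_ (fun j => ?_) j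
    · simp
    · simp [Fin.removeNth]
  have hx : ∑ k : Fin m, x i (ξ k) • ξ.dualBasis k = x i := by
    simp
  simp_rw [hcons, ← AlternatingMap.neg_one_pow_smul_map_insertNth ψ i, Fin.insertNth_removeNth,
    zsmul_eq_mul, Int.cast_pow, Int.cast_neg, Int.cast_one,
    mul_left_comm _ ((-1 : ℂ) ^ (i : ℕ)), ← smul_eq_mul (x i _),
    ← AlternatingMap.map_update_smul]
  rw [← Finset.mul_sum, ← AlternatingMap.map_update_sum, hx, Function.update_eq_self]

/-- For every natural number `p` and every `ℂ`-valued alternating `p`-linear map `ψ`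
on `E*`, we have `c(j(ψ)) = p!·(m − p)·ψ`, where `m = dim E`. -/
theorem cRaw_jRaw (E : Type*) [AddCommGroup E] [Module ℂ E] (m : ℕ)
    (ξ : Basis (Fin m) ℂ E) (p : ℕ)
    (ψ : (Module.Dual ℂ E) [⋀^(Fin p)]→ₗ[ℂ] ℂ)
    (x : Fin p → Module.Dual ℂ E) :
    cRaw ξ (jRaw ψ) x = (p.factorial : ℂ) * ((m : ℂ) - (p : ℂ)) * ψ x := by
  have hfirst (k : Fin m) : ξ.dualBasis k (ξ k) = 1 := by
    rw [Basis.dualBasis_apply_self, if_pos rfl]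
  have hrest (i : Fin p) : ∑ k : Fin m, (-1 : ℂ) ^ ((i : ℕ) + 1) *
      (ψ (fun j => (Fin.cons (ξ.dualBasis k) x : Fin (p + 1) → Module.Dual ℂ E)
        (i.succ.succAbove j)) * x i (ξ k)) = -ψ x := by
    have hsq : (-1 : ℂ) ^ (i : ℕ) * (-1) ^ (i : ℕ) = 1 := by
      rw [← mul_pow]; simp
    simp_rw [mul_comm (ψ _)]
    rw [← Finset.mul_sum, sum_apply_cons_dualBasis_succAbove]
    linear_combination -ψ x * hsq
  simp only [cRaw, jRaw, LinearMap.smul_apply, LinearMap.add_apply, LinearMap.sum_apply,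
    smul_eq_mul, ← Finset.mul_sum, Fin.sum_univ_succ, Finset.sum_add_distrib, Fin.cons_zero,
    Fin.cons_succ, Fin.val_succ, Fin.succAbove_zero, hfirst]
  rw [Finset.sum_comm, Finset.sum_congr rfl fun i _ => hrest i]
  simp
  ring
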